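/- In any CPmem-algebra that additionally satisfies F ◁ x ▷ F = F for all x, the static axiom (CPstat) holds: for all x, y, z, u, v, (x ◁ y ▷ z) ◁ u ▷ v = (x ◁ u ▷ v) ◁ y ▷ (z ◁ u ▷ v). -/

import Mathlib

/-- A CPmem-algebra: a type with constants `T`, `F` and Hoare's ternary conditional
`cond x y z` (written `x ◁ y ▷ z`) satisfying (CP1)–(CP4) and (CPmem). -/
structure CPmemAlg (M : Type*) where
  T : M
  F : M
  cond : M → M → M → M
  cp1 : ∀ x y, cond x T y = x
  cp2 : ∀ x y, cond x F y = y
  cp3 : ∀ x, cond T x F = x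
  cp4 : ∀ x y z u v, cond x (cond y z u) v = cond (cond x y v) z (cond x u v)
  cpmem : ∀ x y z u v w,
    cond x y (cond z u (cond v y w)) = cond x y (cond z u w)

namespace CPmemAlg
variable {M : Type*}
/-- Negation: `¬x = F ◁ x ▷ T`. -/
def neg (A : CPmemAlg M) (x : M) : M := A.cond A.F x A.T
/-- Left-sequential conjunction: `x ∧· y = y ◁ x ▷ F`. -/
def sand (A : CPmemAlg M) (x y : M) : M := A.cond y x A.F
/-- Left-sequential disjunction: `x ∨· y = ¬(¬x ∧· ¬y)`. -/
def sor (A : CPmemAlg M) (x y : M) : M := A.neg (A.sand (A.neg x) (A.neg y))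
end CPmemAlg

namespace CPmemAlg
variable {M : Type*}

theorem cond_neg (A : CPmemAlg M) (x y z : M) : A.cond x (A.neg y) z = A.cond z y x := by
  rw [neg, A.cp4, A.cp2, A.cp1]

/-- If `F ◁ x ▷ F = F` for all `x`, then a conditional with equal branches is that branch. -/
theorem cond_self (A : CPmemAlg M) (hF : ∀ x, A.cond A.F x A.F = A.F) (x y : M) :
    A.cond x y x = x := by
  have h := A.cp4 x A.F y A.F x
  rwa [hF, A.cp2, eq_comm] at h

/-- Memory of a negative outcome of `y`, in the positive branch of the inner conditional. -/
theorem cond_mem_neg (A : CPmemAlg M) (x y z u v w : M) :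
    A.cond x y (A.cond (A.cond v y w) u z) = A.cond x y (A.cond w u z) := by
  simpa only [cond_neg] using A.cpmem x y z (A.neg u) v w

/-- Memory of a positive outcome of `y`, in the positive branch of the inner conditional. -/
theorem cond_mem_pos (A : CPmemAlg M) (x y z u v w : M) :
    A.cond (A.cond (A.cond v y w) u z) y x = A.cond (A.cond v u z) y x := by
  simpa only [cond_neg] using A.cond_mem_neg x (A.neg y) z u w v

end CPmemAlg

/-- In any CPmem-algebra additionally satisfying `F ◁ x ▷ F = F`, the static
axiom (CPstat) holds:
`(x ◁ y ▷ z) ◁ u ▷ v = (x ◁ u ▷ v) ◁ y ▷ (z ◁ u ▷ v)`. -/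
theorem CPmemAlg.cpstat_of_FcondF {M : Type*} (A : CPmemAlg M)
    (hF : ∀ x, A.cond A.F x A.F = A.F) (x y z u v : M) :
    A.cond (A.cond x y z) u v =
      A.cond (A.cond x u v) y (A.cond z u v) := by
  rw [← A.cond_self hF (A.cond (A.cond x y z) u v) y, A.cond_mem_pos, A.cond_mem_neg]
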